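/- Let β₁, β₂ ∈ (0,1) with β₁ + β₂ < 1, and let s : [0,1]³ → [0,1]³ be the solenoid-like map s(x,y,z) = (β₁x, β₁y, 2z) if z ≤ 1/2 and s(x,y,z) = (1 − β₂ + β₂x, 1 − β₂ + β₂y, 2z − 1) if z > 1/2. Let Λ ⊆ ℝ² be the attractor of the planar similitudes T₁(x,y) = (β₁x, β₁y), T₂(x,y) = (1 − β₂ + β₂x, 1 − β₂ + β₂y), and let D solve β₁^D + β₂^D = 1. Then the Li-Yorke pairs of s in the attractor Λ × [0,1] have full Hausdorff dimension: dim_H LY_s(Λ × [0,1]) = dim_H((Λ × [0,1]) × (Λ × [0,1])) = 2(D + 1). -/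

import Mathlib

open Filter Set

noncomputable section

/-- The set of Li-Yorke pairs of a map `f` inside an invariant set `Λ`. -/
def liYorkePairs {E : Type*} [PseudoMetricSpace E] (f : E → E) (Λ : Set E) :
    Set (E × E) :=
  {p | p.1 ∈ Λ ∧ p.2 ∈ Λ ∧
    liminf (fun n : ℕ => dist (f^[n] p.1) (f^[n] p.2)) atTop = 0 ∧
    0 < limsup (fun n : ℕ => dist (f^[n] p.1) (f^[n] p.2)) atTop}

section Dimension

open MeasureTheory Measure Metric
open scoped ENNReal NNReal Topology

/-- `A` is covered by `O(r ^ (-d))` sets of diameter at most `r`, for all `r ∈ (0, 1]`. -/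
def HasCovers {X : Type*} [PseudoEMetricSpace X] (A : Set X) (d : ℝ) : Prop :=
  ∃ K : ℝ, ∀ r : ℝ, 0 < r → r ≤ 1 → ∃ t : Finset (Set X), (t.card : ℝ) ≤ K * r ^ (-d) ∧
    A ⊆ ⋃₀ t ∧ ∀ U ∈ t, ediam U ≤ ENNReal.ofReal r

theorem ediam_prod_le_max {X Y : Type*} [PseudoEMetricSpace X] [PseudoEMetricSpace Y]
    (U : Set X) (V : Set Y) : ediam (U ×ˢ V) ≤ max (ediam U) (ediam V) := by
  refine ediam_le fun p hp q hq => ?_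
  rw [Prod.edist_eq]
  exact max_le_max (edist_le_ediam_of_mem hp.1 hq.1) (edist_le_ediam_of_mem hp.2 hq.2)

theorem HasCovers.prod {X Y : Type*} [PseudoEMetricSpace X] [PseudoEMetricSpace Y]
    {A : Set X} {B : Set Y} {d e : ℝ} (hA : HasCovers A d) (hB : HasCovers B e) :
    HasCovers (A ×ˢ B) (d + e) := by
  classical
  obtain ⟨K, hK⟩ := hA
  obtain ⟨L, hL⟩ := hB
  refine ⟨K * L, fun r hr hr1 => ?_⟩
  obtain ⟨t, htc, htA, htd⟩ := hK r hr hr1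
  obtain ⟨u, huc, huB, hud⟩ := hL r hr hr1
  refine ⟨(t ×ˢ u).image fun p => p.1 ×ˢ p.2, ?_, ?_, ?_⟩
  · have h1 : (((t ×ˢ u).image fun p => p.1 ×ˢ p.2).card : ℝ) ≤ (t.card : ℝ) * u.card := by
      exact_mod_cast Finset.card_image_le.trans (Finset.card_product t u).le
    have h2 : (t.card : ℝ) * u.card ≤ K * r ^ (-d) * (L * r ^ (-e)) :=
      mul_le_mul htc huc (by positivity) ((Nat.cast_nonneg _).trans htc)
    calc _ ≤ _ := h1.trans h2
      _ = K * L * r ^ (-(d + e)) := by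
        rw [neg_add, Real.rpow_add hr]; ring
  · rintro ⟨x, y⟩ ⟨hx, hy⟩
    obtain ⟨U, hU, hxU⟩ := htA hx
    obtain ⟨V, hV, hyV⟩ := huB hy
    exact ⟨U ×ˢ V, by
      simp only [Finset.coe_image, Set.mem_image]
      exact ⟨(U, V), by simpa using ⟨hU, hV⟩, rfl⟩, hxU, hyV⟩
  · intro W hW
    obtain ⟨⟨U, V⟩, hUV, rfl⟩ := Finset.mem_image.1 hW
    rw [Finset.mem_product] at hUV
    exact (ediam_prod_le_max U V).trans (max_le (htd U hUV.1) (hud V hUV.2))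

theorem HasCovers.dimH_le {X : Type*} [EMetricSpace X] {A : Set X} {d : ℝ≥0}
    (hA : HasCovers A d) : dimH A ≤ d := by
  borelize X
  obtain ⟨K, hK⟩ := hA
  choose t htc htA htd using fun n : ℕ =>
    hK (1 / ((n : ℝ) + 1)) (by positivity) (by
      rw [div_le_one (by positivity)]; linarith [(Nat.cast_nonneg n : (0 : ℝ) ≤ n)])
  refine dimH_le_of_hausdorffMeasure_ne_top (ne_top_of_le_ne_top (ENNReal.ofReal_ne_top (r := K)) ?_)
  refine (hausdorffMeasure_le_liminf_sum (l := atTop) (ι := fun n => t n) (d : ℝ) A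
    (fun n : ℕ => ENNReal.ofReal (1 / ((n : ℝ) + 1))) ?_ (fun n U => (U : Set X))
    (Eventually.of_forall fun n U => htd n U U.2) (Eventually.of_forall fun n x hx => ?_)).trans ?_
  · simpa using ENNReal.tendsto_ofReal (tendsto_one_div_add_atTop_nhds_zero_nat (𝕜 := ℝ))
  · obtain ⟨U, hU, hxU⟩ := htA n hx
    exact mem_iUnion.2 ⟨⟨U, hU⟩, hxU⟩
  · refine liminf_le_of_frequently_le' (Frequently.of_forall fun n => ?_)
    have hr : (0 : ℝ) < 1 / ((n : ℝ) + 1) := by positivity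
    calc ∑ U : t n, ediam (U : Set X) ^ (d : ℝ)
        ≤ ∑ _U : t n, ENNReal.ofReal (1 / ((n : ℝ) + 1)) ^ (d : ℝ) :=
          Finset.sum_le_sum fun U _ => ENNReal.rpow_le_rpow (htd n U U.2) d.2
      _ = ENNReal.ofReal ((t n).card * (1 / ((n : ℝ) + 1)) ^ (d : ℝ)) := by
          rw [ENNReal.ofReal_mul (by positivity), ENNReal.ofReal_rpow_of_pos hr]
          simp
      _ ≤ ENNReal.ofReal K := by
          refine ENNReal.ofReal_le_ofReal ?_
          calc _ ≤ K * (1 / ((n : ℝ) + 1)) ^ (-(d : ℝ)) * (1 / ((n : ℝ) + 1)) ^ (d : ℝ) := by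
                gcongr
                exact htc n
            _ = K := by
                rw [mul_assoc, ← Real.rpow_add hr]; simp

theorem hasCovers_of_subset_image_union {X : Type*} [PseudoEMetricSpace X] {A : Set X}
    (hA1 : ediam A ≤ 1) {T₁ T₂ : X → X} {b₁ b₂ : ℝ≥0} (h₁ : LipschitzWith b₁ T₁)
    (h₂ : LipschitzWith b₂ T₂) (hb₁ : b₁ ∈ Ioo 0 1) (hb₂ : b₂ ∈ Ioo 0 1)
    (hA : A ⊆ T₁ '' A ∪ T₂ '' A) {d : ℝ} (hd0 : 0 < d)
    (hd : (b₁ : ℝ) ^ d + (b₂ : ℝ) ^ d = 1) : HasCovers A d := by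
  classical
  have p₁ : (0 : ℝ) < b₁ := by exact_mod_cast hb₁.1
  have p₂ : (0 : ℝ) < b₂ := by exact_mod_cast hb₂.1
  have q₁ : (b₁ : ℝ) < 1 := by exact_mod_cast hb₁.2
  have q₂ : (b₂ : ℝ) < 1 := by exact_mod_cast hb₂.2
  set m : ℝ := min b₁ b₂ with hm
  set M : ℝ := max b₁ b₂ with hM
  have hm0 : 0 < m := lt_min p₁ p₂
  have hM0 : 0 < M := lt_max_of_lt_left p₁
  have hM1 : M < 1 := max_lt q₁ q₂
  have key : ∀ n : ℕ, ∀ r : ℝ, M ^ n ≤ r → m * r ≤ 1 → ∃ t : Finset (Set X),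
      (t.card : ℝ) ≤ (m * r) ^ (-d) ∧ A ⊆ ⋃₀ t ∧ ∀ U ∈ t, ediam U ≤ ENNReal.ofReal r := by
    have base : ∀ r : ℝ, 1 ≤ r → m * r ≤ 1 → ∃ t : Finset (Set X),
        (t.card : ℝ) ≤ (m * r) ^ (-d) ∧ A ⊆ ⋃₀ t ∧ ∀ U ∈ t, ediam U ≤ ENNReal.ofReal r := by
      intro r hr hmr
      refine ⟨{A}, ?_, by simp, ?_⟩
      · have : 0 < m * r := by positivity
        simpa using Real.one_le_rpow_of_pos_of_le_one_of_nonpos this hmr (by linarith)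
      · simpa using hA1.trans (ENNReal.one_le_ofReal.2 hr)
    intro n
    induction n with
    | zero => intro r hr; exact base r (by simpa using hr)
    | succ n ih =>
      intro r hr hmr
      rcases le_or_gt 1 r with h | h
      · exact base r h hmr
      have hr0 : 0 < r := (pow_pos hM0 _).trans_le hr
      have scale : ∀ b : ℝ≥0, (0 : ℝ) < b → (b : ℝ) ≤ M → m ≤ b → ∀ T : X → X,
          LipschitzWith b T → ∃ t : Finset (Set X),
          (t.card : ℝ) ≤ (m * r) ^ (-d) * (b : ℝ) ^ d ∧ T '' A ⊆ ⋃₀ t ∧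
            ∀ U ∈ t, ediam U ≤ ENNReal.ofReal r := by
        intro b hb hbM hmb T hT
        obtain ⟨t, htc, htA, htd⟩ := ih (r / b)
          (by rw [le_div_iff₀ hb]
              calc M ^ n * b ≤ M ^ n * M := by gcongr
                _ ≤ r := by rwa [← pow_succ])
          (by rw [← mul_div_assoc, div_le_one hb]; nlinarith)
        refine ⟨t.image (T '' ·), ?_, ?_, ?_⟩
        · calc ((t.image (T '' ·)).card : ℝ) ≤ t.card := by exact_mod_cast Finset.card_image_le
            _ ≤ _ := htc
            _ = _ := by
              rw [← mul_div_assoc, Real.div_rpow (by positivity) hb.le, Real.rpow_neg hb.le,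
                div_inv_eq_mul]
        · rintro _ ⟨x, hx, rfl⟩
          obtain ⟨U, hU, hxU⟩ := htA hx
          exact ⟨T '' U, by
            rw [Finset.coe_image]; exact mem_image_of_mem _ hU, mem_image_of_mem _ hxU⟩
        · intro V hV
          obtain ⟨U, hU, rfl⟩ := Finset.mem_image.1 hV
          calc ediam (T '' U) ≤ b * ediam U := hT.ediam_image_le U
            _ ≤ b * ENNReal.ofReal (r / b) := by gcongr; exact htd U hU
            _ = ENNReal.ofReal r := by
              rw [← ENNReal.ofReal_coe_nnreal, ← ENNReal.ofReal_mul hb.le, mul_div_cancel₀ _ hb.ne']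
      obtain ⟨t, htc, htA, htd⟩ := scale b₁ p₁ (le_max_left _ _) (min_le_left _ _) T₁ h₁
      obtain ⟨u, huc, huA, hud⟩ := scale b₂ p₂ (le_max_right _ _) (min_le_right _ _) T₂ h₂
      refine ⟨t ∪ u, ?_, ?_, fun U hU => (Finset.mem_union.1 hU).elim (htd U) (hud U)⟩
      · calc ((t ∪ u).card : ℝ) ≤ t.card + u.card := by exact_mod_cast Finset.card_union_le t u
          _ ≤ (m * r) ^ (-d) * (b₁ : ℝ) ^ d + (m * r) ^ (-d) * (b₂ : ℝ) ^ d := add_le_add htc huc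
          _ = (m * r) ^ (-d) := by rw [← mul_add, hd, mul_one]
      · rw [Finset.coe_union, sUnion_union]
        exact hA.trans (union_subset_union htA huA)
  refine ⟨m ^ (-d), fun r hr hr1 => ?_⟩
  obtain ⟨n, hn⟩ := exists_pow_lt_of_lt_one hr hM1
  have hmM : m < 1 := (min_le_left _ _).trans_lt q₁
  obtain ⟨t, ht⟩ := key n r hn.le (by nlinarith)
  exact ⟨t, by rw [← Real.mul_rpow hm0.le hr.le]; exact ht.1, ht.2⟩

/-- `μ U = O(diam U ^ d)` for all sets `U`. -/
def IsFrostman {X : Type*} [PseudoEMetricSpace X] [MeasurableSpace X] (μ : Measure X) (d : ℝ) :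
    Prop :=
  ∃ K : ℝ≥0, ∀ U : Set X, μ U ≤ K * ediam U ^ d

theorem IsFrostman.prod {X Y : Type*} [PseudoEMetricSpace X] [PseudoEMetricSpace Y]
    [MeasurableSpace X] [MeasurableSpace Y] {μ : Measure X} {ν : Measure Y} [SFinite ν]
    {d e : ℝ} (hd : 0 ≤ d) (he : 0 ≤ e) (hμ : IsFrostman μ d) (hν : IsFrostman ν e) :
    IsFrostman (μ.prod ν) (d + e) := by
  obtain ⟨K, hK⟩ := hμ
  obtain ⟨L, hL⟩ := hν
  refine ⟨K * L, fun U => ?_⟩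
  have h1 : ediam (Prod.fst '' U) ≤ ediam U := by
    simpa using LipschitzWith.prod_fst.ediam_image_le U
  have h2 : ediam (Prod.snd '' U) ≤ ediam U := by
    simpa using LipschitzWith.prod_snd.ediam_image_le U
  calc μ.prod ν U ≤ μ.prod ν ((Prod.fst '' U) ×ˢ (Prod.snd '' U)) :=
        measure_mono fun p hp => ⟨mem_image_of_mem _ hp, mem_image_of_mem _ hp⟩
    _ = μ (Prod.fst '' U) * ν (Prod.snd '' U) := prod_prod _ _
    _ ≤ (K * ediam U ^ d) * (L * ediam U ^ e) := by
        gcongr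
        · exact (hK _).trans (by gcongr)
        · exact (hL _).trans (by gcongr)
    _ = _ := by
        rw [ENNReal.rpow_add_of_nonneg _ _ hd he, ENNReal.coe_mul]; ring

theorem IsFrostman.le_dimH {X : Type*} [EMetricSpace X] [MeasurableSpace X] [BorelSpace X]
    {μ : Measure X} {d : ℝ≥0} (hμ : IsFrostman μ d) {A : Set X} (hA : μ A ≠ 0) :
    d ≤ dimH A := by
  obtain ⟨K, hK⟩ := hμ
  have hK0 : (K : ℝ≥0∞) ≠ 0 := by
    rintro h
    exact hA (by simpa [h] using hK A)
  have hle : (K : ℝ≥0∞)⁻¹ • μ ≤ μH[(d : ℝ)] := by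
    refine le_hausdorffMeasure _ _ 1 one_pos fun U _ => ?_
    rw [Measure.smul_apply, smul_eq_mul]
    calc (K : ℝ≥0∞)⁻¹ * μ U ≤ (K : ℝ≥0∞)⁻¹ * (K * ediam U ^ (d : ℝ)) := by
          gcongr
          exact hK U
      _ = ediam U ^ (d : ℝ) := by
          rw [← mul_assoc, ENNReal.inv_mul_cancel hK0 ENNReal.coe_ne_top, one_mul]
  refine le_dimH_of_hausdorffMeasure_ne_zero fun h => ?_
  have := hle A
  rw [h, Measure.smul_apply, smul_eq_mul, nonpos_iff_eq_zero, mul_eq_zero] at this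
  exact this.elim (by simp) hA

end Dimension

section SelfSimilar

open MeasureTheory Measure Metric
open scoped ENNReal NNReal Topology

/-- Prepending an independent symbol to a Bernoulli sequence gives a Bernoulli sequence. -/
theorem map_cons_prod_infinitePi {ι : Type*} [MeasurableSpace ι] (ρ : Measure ι)
    [IsProbabilityMeasure ρ] :
    (ρ.prod (infinitePi fun _ : ℕ => ρ)).map (fun x k => Nat.casesOn k x.1 x.2) =
      infinitePi fun _ : ℕ => ρ := by
  classical
  have hmeas : Measurable (fun (x : ι × (ℕ → ι)) (k : ℕ) => (Nat.casesOn k x.1 x.2 : ι)) := by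
    refine measurable_pi_lambda _ fun k => ?_
    cases k with
    | zero => exact measurable_fst
    | succ k => exact (measurable_pi_apply k).comp measurable_snd
  refine eq_infinitePi _ fun s t ht => ?_
  set t' : ℕ → Set ι := fun i => if i ∈ s then t i else univ with ht'
  have mt' : ∀ i, MeasurableSet (t' i) := fun i => by
    by_cases h : i ∈ s <;> simp [t', h, ht i]
  obtain ⟨N, hN⟩ : ∃ N, s ⊆ Finset.range (N + 1) :=
    ⟨s.sup id, fun i hi => Finset.mem_range_succ_iff.2 (Finset.le_sup (f := id) hi)⟩
  have hpi : Set.pi (s : Set ℕ) t = Set.pi (Finset.range (N + 1) : Set ℕ) t' := by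
    ext ω
    simp only [Set.mem_pi, Finset.mem_coe]
    constructor
    · intro h i _
      by_cases hi : i ∈ s <;> simp [t', hi, h]
    · intro h i hi
      simpa [t', hi] using h i (hN hi)
  have hprod : ∏ i ∈ s, ρ (t i) = ∏ i ∈ Finset.range (N + 1), ρ (t' i) := by
    refine Finset.prod_subset_one_on_sdiff hN (fun i hi => ?_) fun i hi => by simp [t', hi]
    simp [t', (Finset.mem_sdiff.1 hi).2]
  rw [hpi, hprod, map_apply hmeas (MeasurableSet.pi (Finset.countable_toSet _) fun i _ => mt' i),
    Finset.prod_range_succ', ← infinitePi_pi (fun _ => ρ) (t := fun i => t' (i + 1))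
      (fun i _ => mt' (i + 1)), mul_comm, ← prod_prod]
  congr 1
  ext ⟨i, ω⟩
  simp only [mem_preimage, Set.mem_pi, Finset.mem_coe, Finset.mem_range, mem_prod]
  constructor
  · exact fun h => ⟨h 0 (by omega), fun k hk => h (k + 1) (by omega)⟩
  · rintro ⟨h0, h⟩ k hk
    cases k with
    | zero => exact h0
    | succ k => exact h k (by omega)

/-- The point obtained from `q` by applying the maps coded by the first `n` symbols of `ω`. -/
def codedPoint {ι X : Type*} (T : ι → X → X) (q : X) : ℕ → (ℕ → ι) → X
  | 0, _ => q
  | n + 1, ω => T (ω 0) (codedPoint T q n fun k => ω (k + 1))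

theorem exists_selfSimilar_measure {ι X : Type*} [MeasurableSpace ι] [DiscreteMeasurableSpace ι]
    [Countable ι] [MetricSpace X] [CompleteSpace X] [MeasurableSpace X] [BorelSpace X]
    (ρ : Measure ι) [IsProbabilityMeasure ρ] (T : ι → X → X) {b : ℝ≥0} (hb : b < 1)
    (hT : ∀ i, LipschitzWith b (T i)) {Λ : Set X} (hΛc : IsCompact Λ) (hΛne : Λ.Nonempty)
    (hΛ : ∀ i, MapsTo (T i) Λ Λ) :
    ∃ μ : Measure X, IsProbabilityMeasure μ ∧ μ Λᶜ = 0 ∧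
      ∀ U, MeasurableSet U → μ U = ∫⁻ i, μ (T i ⁻¹' U) ∂ρ := by
  obtain ⟨q, hq⟩ := hΛne
  have hmem : ∀ n ω, codedPoint T q n ω ∈ Λ := by
    intro n
    induction n with
    | zero => exact fun _ => hq
    | succ n ih => exact fun ω => hΛ _ (ih _)
  have hmeas : ∀ n, Measurable (codedPoint T q n) := by
    intro n
    induction n with
    | zero => exact measurable_const
    | succ n ih =>
      have h : Measurable (Function.uncurry T) :=
        measurable_from_prod_countable_right fun i => (hT i).continuous.measurable
      have hshift : Measurable fun (ω : ℕ → ι) (k : ℕ) => ω (k + 1) :=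
        measurable_pi_lambda _ fun k => measurable_pi_apply (k + 1)
      exact h.comp ((measurable_pi_apply (0 : ℕ)).prodMk (ih.comp hshift))
  have hdist : ∀ n ω, dist (codedPoint T q n ω) (codedPoint T q (n + 1) ω) ≤
      diam Λ * (b : ℝ) ^ n := by
    intro n
    induction n with
    | zero =>
      intro ω
      simpa using dist_le_diam_of_mem hΛc.isBounded (hmem 0 ω) (hmem 1 ω)
    | succ n ih =>
      intro ω
      refine ((hT (ω 0)).dist_le_mul _ _).trans ?_
      calc _ ≤ (b : ℝ) * (diam Λ * (b : ℝ) ^ n) := by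
            gcongr
            exact ih _
        _ = _ := by ring
  choose π hπ using fun ω => cauchySeq_tendsto_of_complete
    (cauchySeq_of_le_geometric (b : ℝ) (diam Λ) (by exact_mod_cast hb) fun n => hdist n ω)
  have hπm : Measurable π := measurable_of_tendsto_metrizable hmeas (tendsto_pi_nhds.2 hπ)
  have hπΛ : ∀ ω, π ω ∈ Λ := fun ω =>
    hΛc.isClosed.mem_of_tendsto (hπ ω) (Eventually.of_forall fun n => hmem n ω)
  have hcons : ∀ i (ω : ℕ → ι), π (fun k => Nat.casesOn k i ω) = T i (π ω) := by
    intro i ω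
    refine tendsto_nhds_unique ((hπ (fun k => Nat.casesOn k i ω)).comp (tendsto_add_atTop_nat 1)) ?_
    exact ((hT i).continuous.tendsto _).comp (hπ ω)
  set P := infinitePi fun _ : ℕ => ρ with hP
  refine ⟨P.map π, isProbabilityMeasure_map hπm.aemeasurable, ?_, fun U hU => ?_⟩
  · rw [map_apply hπm hΛc.isClosed.measurableSet.compl]
    convert! measure_empty (μ := P)
    ext ω
    simpa using hπΛ ω
  · have hmeas' : Measurable (fun (x : ι × (ℕ → ι)) (k : ℕ) => (Nat.casesOn k x.1 x.2 : ι)) := by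
      refine measurable_pi_lambda _ fun k => ?_
      cases k with
      | zero => exact measurable_fst
      | succ k => exact (measurable_pi_apply k).comp measurable_snd
    rw [map_apply hπm hU]
    conv_lhs => rw [hP, ← map_cons_prod_infinitePi ρ]
    rw [map_apply hmeas' (hπm hU), prod_apply (hmeas' (hπm hU))]
    refine lintegral_congr fun i => ?_
    rw [map_apply hπm ((hT i).continuous.measurable hU)]
    congr 1
    ext ω
    simp only [mem_preimage]
    rw [hcons]

theorem isFrostman_of_selfSimilar {X : Type*} [MetricSpace X] [MeasurableSpace X] [BorelSpace X]
    {μ : Measure X} [IsProbabilityMeasure μ] {Λ : Set X} (hμΛ : μ Λᶜ = 0) {T : Bool → X → X}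
    {b : Bool → ℝ≥0} (hb : ∀ i, b i ∈ Ioo 0 1)
    (hT : ∀ i x y, edist (T i x) (T i y) = b i * edist x y) {δ : ℝ≥0} (hδ : 0 < δ)
    (hsep : ∀ x ∈ Λ, ∀ y ∈ Λ, δ ≤ edist (T false x) (T true y)) {d : ℝ} (hd : 0 < d)
    (hμ : ∀ U, MeasurableSet U → μ U =
      (b false : ℝ≥0∞) ^ d * μ (T false ⁻¹' U) + (b true : ℝ≥0∞) ^ d * μ (T true ⁻¹' U)) :
    IsFrostman μ d := by
  set K : ℝ≥0∞ := (δ : ℝ≥0∞)⁻¹ ^ d with hK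
  have hδ0 : (δ : ℝ≥0∞) ≠ 0 := by exact_mod_cast hδ.ne'
  have hKtop : K ≠ ⊤ := ENNReal.rpow_ne_top_of_nonneg hd.le (ENNReal.inv_ne_top.2 hδ0)
  set p : ℝ≥0∞ := max ((b false : ℝ≥0∞) ^ d) ((b true : ℝ≥0∞) ^ d) with hp
  have hp1 : p < 1 := max_lt
    (ENNReal.rpow_lt_one (by exact_mod_cast (hb false).2) hd)
    (ENNReal.rpow_lt_one (by exact_mod_cast (hb true).2) hd)
  have hbp : ∀ i, (b i : ℝ≥0∞) ^ d ≤ p := by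
    intro i
    cases i
    · exact le_max_left _ _
    · exact le_max_right _ _
  have key : ∀ n : ℕ, ∀ U : Set X, μ U ≤ K * ediam U ^ d + p ^ n := by
    intro n
    induction n with
    | zero =>
      intro U
      simpa using (prob_le_one (μ := μ)).trans (le_add_self (a := 1) (b := K * ediam U ^ d))
    | succ n ih =>
      intro U
      rcases le_or_gt (δ : ℝ≥0∞) (ediam U) with hU | hU
      · calc μ U ≤ 1 := prob_le_one
          _ = K * (δ : ℝ≥0∞) ^ d := by
              rw [hK, ← ENNReal.mul_rpow_of_nonneg _ _ hd.le,
                ENNReal.inv_mul_cancel hδ0 ENNReal.coe_ne_top, ENNReal.one_rpow]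
          _ ≤ K * ediam U ^ d := by gcongr
          _ ≤ _ := le_self_add
      have hi : ∀ i, (b i : ℝ≥0∞) ^ d * μ (T i ⁻¹' closure U) ≤ K * ediam U ^ d + p ^ (n + 1) := by
        intro i
        have hbi0 : (b i : ℝ≥0∞) ≠ 0 := by exact_mod_cast (hb i).1.ne'
        have hdiam : ediam (T i ⁻¹' closure U) ≤ ediam U / b i := by
          refine ediam_le fun x hx y hy => ?_
          rw [ENNReal.le_div_iff_mul_le (Or.inl hbi0) (Or.inl ENNReal.coe_ne_top), mul_comm,
            ← hT, ← ediam_closure U]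
          exact edist_le_ediam_of_mem hx hy
        calc (b i : ℝ≥0∞) ^ d * μ (T i ⁻¹' closure U)
            ≤ (b i : ℝ≥0∞) ^ d * (K * (ediam U / b i) ^ d + p ^ n) := by
              gcongr
              exact (ih _).trans (by gcongr)
          _ = K * ((b i : ℝ≥0∞) * (ediam U / b i)) ^ d + (b i : ℝ≥0∞) ^ d * p ^ n := by
              rw [ENNReal.mul_rpow_of_nonneg _ _ hd.le]; ring
          _ ≤ K * ediam U ^ d + p ^ (n + 1) := by
              rw [ENNReal.mul_div_cancel hbi0 ENNReal.coe_ne_top, pow_succ']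
              gcongr
              exact hbp i
      have hnull : ∀ i, (∀ x ∈ Λ, T i x ∉ closure U) → μ (T i ⁻¹' closure U) = 0 := fun i h =>
        measure_mono_null (fun x hx hxΛ => h x hxΛ hx) hμΛ
      refine (measure_mono subset_closure).trans ?_
      rw [hμ _ isClosed_closure.measurableSet]
      by_cases h : ∀ x ∈ Λ, T false x ∉ closure U
      · rw [hnull false h, mul_zero, zero_add]
        exact hi true
      · push Not at h
        obtain ⟨x, hx, hxU⟩ := h
        rw [hnull true, mul_zero, add_zero]
        · exact hi false
        · intro y hy hyU
          refine hU.not_ge ((hsep x hx y hy).trans ?_)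
          rw [← ediam_closure U]
          exact edist_le_ediam_of_mem hxU hyU
  refine ⟨K.toNNReal, fun U => ?_⟩
  rw [ENNReal.coe_toNNReal hKtop]
  refine ge_of_tendsto' (f := fun n : ℕ => K * ediam U ^ d + p ^ n) (x := atTop) ?_
    fun n => key n U
  simpa using tendsto_const_nhds.add (ENNReal.tendsto_pow_atTop_nhds_zero_of_lt_one hp1)

end SelfSimilar

section Doubling

open MeasureTheory Measure
open scoped Topology

theorem Ergodic.ae_frequently_iterate_mem {α : Type*} [MeasurableSpace α] {μ : Measure α}
    [IsFiniteMeasure μ] {f : α → α} (hf : Ergodic f μ) {O : Set α} (hO : MeasurableSet O)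
    (hO0 : μ O ≠ 0) : ∀ᵐ x ∂μ, ∃ᶠ n in atTop, f^[n] x ∈ O := by
  set W : Set α := ⋃ n : ℕ, f^[n] ⁻¹' O with hW
  have hWm : MeasurableSet W :=
    MeasurableSet.iUnion fun n => (hf.measurable.iterate n) hO
  have hfW : f ⁻¹' W ⊆ W := by
    intro x hx
    obtain ⟨n, hn⟩ := mem_iUnion.1 hx
    exact mem_iUnion.2 ⟨n + 1, hn⟩
  have hWae : ∀ᵐ x ∂μ, x ∈ W := by
    rcases hf.ae_empty_or_univ_of_preimage_ae_le hWm.nullMeasurableSet hfW.eventuallyLE with h | h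
    · exact absurd (measure_mono_null (subset_iUnion (fun n : ℕ => f^[n] ⁻¹' O) 0)
        (ae_eq_empty.1 h)) hO0
    · exact eventuallyEq_univ.1 h
  have hall : ∀ᵐ x ∂μ, ∀ k : ℕ, f^[k] x ∈ W :=
    ae_all_iff.2 fun k => (hf.quasiMeasurePreserving.iterate k).ae hWae
  filter_upwards [hall] with x hx
  refine frequently_atTop.2 fun k => ?_
  obtain ⟨n, hn⟩ := mem_iUnion.1 (hx k)
  exact ⟨n + k, by omega, by rw [Function.iterate_add_apply]; exact hn⟩

theorem ergodic_two_nsmul_torus :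
    Ergodic (fun x : UnitAddCircle × UnitAddCircle => 2 • x)
      ((volume : Measure UnitAddCircle).prod (volume : Measure UnitAddCircle)) := by
  have hiter : ∀ (n : ℕ) (x : UnitAddCircle × UnitAddCircle),
      (nsmulAddMonoidHom (α := UnitAddCircle × UnitAddCircle) 2)^[n] x = 2 ^ n • x := by
    intro n
    induction n with
    | zero => simp
    | succ n ih =>
      intro x
      rw [Function.iterate_succ_apply', ih, nsmulAddMonoidHom_apply, smul_smul, pow_succ']
  refine AddMonoidHom.ergodic_of_dense_iUnion_preimage_zero
    (nsmulAddMonoidHom (α := UnitAddCircle × UnitAddCircle) 2) ?_ ?_ ?_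
  · have happrox : ∀ x : ℝ,
        Tendsto (fun n : ℕ => (⌊x * 2 ^ n⌋ : ℝ) / 2 ^ n) atTop (𝓝 x) := by
      intro x
      have h0 : Tendsto (fun n : ℕ => x - (1 / 2 : ℝ) ^ n) atTop (𝓝 x) := by
        simpa using tendsto_const_nhds.sub
          (tendsto_pow_atTop_nhds_zero_of_lt_one (r := (1 / 2 : ℝ)) (by norm_num) (by norm_num))
      refine tendsto_of_tendsto_of_tendsto_of_le_of_le h0 tendsto_const_nhds (fun n => ?_)
        fun n => ?_
      · have hp : (0 : ℝ) < 2 ^ n := by positivity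
        simp only [one_div, inv_pow]
        rw [le_div_iff₀ hp, sub_mul, inv_mul_cancel₀ hp.ne']
        exact (Int.sub_one_lt_floor _).le
      · exact (div_le_iff₀ (by positivity)).2 (Int.floor_le _)
    have hzero : ∀ (x : ℝ) (n : ℕ),
        2 ^ n • (((⌊x * 2 ^ n⌋ : ℝ) / 2 ^ n : ℝ) : UnitAddCircle) = 0 := by
      intro x n
      rw [← AddCircle.coe_nsmul, nsmul_eq_mul, Nat.cast_pow, Nat.cast_ofNat,
        mul_div_cancel₀ _ (by positivity), AddCircle.coe_eq_zero_iff]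
      exact ⟨⌊x * 2 ^ n⌋, by simp⟩
    rintro ⟨a, b⟩
    induction a using QuotientAddGroup.induction_on with | _ x =>
    induction b using QuotientAddGroup.induction_on with | _ y =>
    refine mem_closure_of_tendsto (f := fun n : ℕ =>
      ((((⌊x * 2 ^ n⌋ : ℝ) / 2 ^ n : ℝ) : UnitAddCircle),
        (((⌊y * 2 ^ n⌋ : ℝ) / 2 ^ n : ℝ) : UnitAddCircle))) (b := atTop) ?_ ?_
    · exact (((AddCircle.continuous_mk' 1).tendsto x).comp (happrox x)).prodMk_nhds
        (((AddCircle.continuous_mk' 1).tendsto y).comp (happrox y))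
    · refine Eventually.of_forall fun n => mem_iUnion.2 ⟨n, ?_⟩
      rw [mem_preimage, hiter]
      exact Prod.ext (hzero x n) (hzero y n)
  · exact continuous_nsmul 2
  · have half : ∀ a : UnitAddCircle, ∃ b : UnitAddCircle, 2 • b = a := by
      intro a
      induction a using QuotientAddGroup.induction_on with | _ x =>
      exact ⟨((x / 2 : ℝ) : UnitAddCircle), by
        rw [← AddCircle.coe_nsmul, nsmul_eq_mul, Nat.cast_ofNat, mul_div_cancel₀ _ two_ne_zero]⟩
    rintro ⟨a, b⟩
    obtain ⟨a', ha⟩ := half a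
    obtain ⟨b', hb⟩ := half b
    exact ⟨(a', b'), Prod.ext ha hb⟩

/-- Almost every pair in the unit square visits every open rectangle infinitely often under
doubling modulo one. -/
theorem ae_frequently_doubling_mem {V W : Set ℝ} (hV : IsOpen V) (hW : IsOpen W)
    (hVne : V.Nonempty) (hWne : W.Nonempty) :
    ∀ᵐ p ∂(volume.restrict (Ioc (0 : ℝ) 1)).prod (volume.restrict (Ioc (0 : ℝ) 1)),
      ∃ᶠ n : ℕ in atTop,
        2 ^ n • (p.1 : UnitAddCircle) ∈ ((↑) : ℝ → UnitAddCircle) '' V ∧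
        2 ^ n • (p.2 : UnitAddCircle) ∈ ((↑) : ℝ → UnitAddCircle) '' W := by
  have hopen : ∀ {S : Set ℝ}, IsOpen S → IsOpen (((↑) : ℝ → UnitAddCircle) '' S) := fun h =>
    QuotientAddGroup.isOpenMap_coe _ h
  have hmk : MeasurePreserving ((↑) : ℝ → UnitAddCircle)
      (volume.restrict (Ioc (0 : ℝ) 1)) volume := by
    simpa using UnitAddCircle.measurePreserving_mk 0
  have hO : IsOpen ((((↑) : ℝ → UnitAddCircle) '' V) ×ˢ (((↑) : ℝ → UnitAddCircle) '' W)) :=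
    (hopen hV).prod (hopen hW)
  have := ergodic_two_nsmul_torus.ae_frequently_iterate_mem hO.measurableSet
    (hO.measure_ne_zero _ ((hVne.image _).prod (hWne.image _)))
  filter_upwards [(hmk.prod hmk).quasiMeasurePreserving.ae this] with p hp
  refine hp.mono fun n hn => ?_
  rw [smul_iterate_apply] at hn
  exact hn

end Doubling

section Solenoid

open MeasureTheory Measure Metric
open scoped ENNReal NNReal Topology

theorem subset_Icc_of_attractor {β₁ β₂ : ℝ} (hβ₁ : β₁ ∈ Ioo (0 : ℝ) 1)
    (hβ₂ : β₂ ∈ Ioo (0 : ℝ) 1) {S : Set ℝ} (hSc : IsCompact S)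
    (hS : ∀ x ∈ S, ∃ y ∈ S, x = β₁ * y ∨ x = 1 - β₂ + β₂ * y) : S ⊆ Icc 0 1 := by
  intro x hx
  obtain ⟨M, hM, hMmax⟩ := hSc.exists_isGreatest ⟨x, hx⟩
  obtain ⟨m, hm, hmmin⟩ := hSc.exists_isLeast ⟨x, hx⟩
  obtain ⟨y, hy, hMy⟩ := hS M hM
  obtain ⟨z, hz, hmz⟩ := hS m hm
  have hyM : y ≤ M := hMmax hy
  have hmz' : m ≤ z := hmmin hz
  have hM1 : M ≤ 1 := by
    rcases hMy with h | h <;> nlinarith [hβ₁.1, hβ₁.2, hβ₂.1, hβ₂.2]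
  have hm0 : 0 ≤ m := by
    rcases hmz with h | h <;> nlinarith [hβ₁.1, hβ₁.2, hβ₂.1, hβ₂.2]
  exact ⟨hm0.trans (hmmin hx), (hMmax hx).trans hM1⟩

theorem eq_of_coe_mem_image {u : ℝ} (hu : u ∈ Ioc (0 : ℝ) 1) {V : Set ℝ} (hV : V ⊆ Ioc 0 1)
    (h : (u : UnitAddCircle) ∈ ((↑) : ℝ → UnitAddCircle) '' V) : u ∈ V := by
  obtain ⟨v, hv, hvu⟩ := h
  have := (AddCircle.coe_eq_coe_iff_of_mem_Ioc (p := (1 : ℝ)) (a := 0) (by simpa using hV hv)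
    (by simpa using hu)).1 hvu
  exact this ▸ hv

theorem dist_similitude (b c : ℝ) (hb : 0 ≤ b) (q r : ℝ × ℝ) :
    dist ((c + b * q.1, c + b * q.2) : ℝ × ℝ) (c + b * r.1, c + b * r.2) = b * dist q r := by
  simp only [Prod.dist_eq, Real.dist_eq, add_sub_add_left_eq_sub, ← mul_sub, abs_mul,
    abs_of_nonneg hb, mul_max_of_nonneg _ _ hb]

variable {β₁ β₂ : ℝ} {s : (ℝ × ℝ) × ℝ → (ℝ × ℝ) × ℝ} {Λ : Set (ℝ × ℝ)}

theorem solenoid_iterate_mem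
    (hs : ∀ p : (ℝ × ℝ) × ℝ,
      s p = if p.2 ≤ 1 / 2 then ((β₁ * p.1.1, β₁ * p.1.2), 2 * p.2)
        else ((1 - β₂ + β₂ * p.1.1, 1 - β₂ + β₂ * p.1.2), 2 * p.2 - 1))
    (h₁ : ∀ q ∈ Λ, (β₁ * q.1, β₁ * q.2) ∈ Λ)
    (h₂ : ∀ q ∈ Λ, (1 - β₂ + β₂ * q.1, 1 - β₂ + β₂ * q.2) ∈ Λ)
    {p : (ℝ × ℝ) × ℝ} (hp : p ∈ Λ ×ˢ Ioc (0 : ℝ) 1) (n : ℕ) :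
    s^[n] p ∈ Λ ×ˢ Ioc (0 : ℝ) 1 ∧
      ((s^[n] p).2 : UnitAddCircle) = 2 ^ n • (p.2 : UnitAddCircle) := by
  induction n with
  | zero => simpa using hp
  | succ n ih =>
    rw [Function.iterate_succ_apply', pow_succ', ← smul_smul, ← ih.2]
    obtain ⟨⟨hΛn, hpos, hle⟩, -⟩ := ih
    generalize s^[n] p = r at *
    rw [hs r, ← AddCircle.coe_nsmul, nsmul_eq_mul, Nat.cast_ofNat]
    split_ifs with h
    · exact ⟨⟨h₁ _ hΛn, by dsimp only; linarith, by dsimp only; linarith⟩, rfl⟩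
    · refine ⟨⟨h₂ _ hΛn, by dsimp only; linarith, by dsimp only; linarith⟩, ?_⟩
      simp only
      rw [AddCircle.coe_sub, AddCircle.coe_period, sub_zero]

theorem solenoid_iterate_of_small
    (hs : ∀ p : (ℝ × ℝ) × ℝ,
      s p = if p.2 ≤ 1 / 2 then ((β₁ * p.1.1, β₁ * p.1.2), 2 * p.2)
        else ((1 - β₂ + β₂ * p.1.1, 1 - β₂ + β₂ * p.1.2), 2 * p.2 - 1))
    (m : ℕ) (p : (ℝ × ℝ) × ℝ) (hp : 2 ^ m * p.2 ≤ 1) :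
    s^[m] p = (β₁ ^ m • p.1, 2 ^ m * p.2) := by
  induction m with
  | zero => simp
  | succ m ih =>
    have hm : 2 ^ m * p.2 ≤ 1 / 2 := by rw [pow_succ'] at hp; linarith
    rw [Function.iterate_succ_apply', ih (by linarith), hs, if_pos hm]
    ext
    · simp [pow_succ']; ring
    · simp [pow_succ']; ring
    · simp [pow_succ']; ring

theorem mem_liYorkePairs_solenoid (hβ₁ : β₁ ∈ Ioo (0 : ℝ) 1) (hβ₂ : β₂ ∈ Ioo (0 : ℝ) 1)
    (hsum : β₁ + β₂ < 1)
    (hs : ∀ p : (ℝ × ℝ) × ℝ,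
      s p = if p.2 ≤ 1 / 2 then ((β₁ * p.1.1, β₁ * p.1.2), 2 * p.2)
        else ((1 - β₂ + β₂ * p.1.1, 1 - β₂ + β₂ * p.1.2), 2 * p.2 - 1))
    (h₁ : ∀ q ∈ Λ, (β₁ * q.1, β₁ * q.2) ∈ Λ)
    (h₂ : ∀ q ∈ Λ, (1 - β₂ + β₂ * q.1, 1 - β₂ + β₂ * q.2) ∈ Λ)
    (hΛ : Λ ⊆ Icc 0 1 ×ˢ Icc 0 1)
    {p q : (ℝ × ℝ) × ℝ} (hp : p ∈ Λ ×ˢ Ioc (0 : ℝ) 1) (hq : q ∈ Λ ×ˢ Ioc (0 : ℝ) 1)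
    (hnear : ∀ m : ℕ, ∃ᶠ n : ℕ in atTop,
      2 ^ n • (p.2 : UnitAddCircle) ∈ ((↑) : ℝ → UnitAddCircle) '' Ioo 0 ((1 / 4) ^ m) ∧
      2 ^ n • (q.2 : UnitAddCircle) ∈ ((↑) : ℝ → UnitAddCircle) '' Ioo 0 ((1 / 4) ^ m))
    (hfar : ∃ᶠ n : ℕ in atTop,
      2 ^ n • (p.2 : UnitAddCircle) ∈ ((↑) : ℝ → UnitAddCircle) '' Ioo 0 (1 / 2) ∧
      2 ^ n • (q.2 : UnitAddCircle) ∈ ((↑) : ℝ → UnitAddCircle) '' Ioo (1 / 2) 1) :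
    (p, q) ∈ liYorkePairs s (Λ ×ˢ Icc (0 : ℝ) 1) := by
  have hmemp := solenoid_iterate_mem hs h₁ h₂ hp
  have hmemq := solenoid_iterate_mem hs h₁ h₂ hq
  have hdΛ : ∀ x ∈ Λ, ∀ y ∈ Λ, dist x y ≤ 1 := by
    intro x hx y hy
    rw [Prod.dist_eq]
    exact max_le (by simpa using Real.dist_le_of_mem_Icc (hΛ hx).1 (hΛ hy).1)
      (by simpa using Real.dist_le_of_mem_Icc (hΛ hx).2 (hΛ hy).2)
  have hdI : ∀ x ∈ Ioc (0 : ℝ) 1, ∀ y ∈ Ioc (0 : ℝ) 1, dist x y ≤ 1 := fun x hx y hy => by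
    simpa using Real.dist_le_of_mem_Icc (Ioc_subset_Icc_self hx) (Ioc_subset_Icc_self hy)
  have hle : ∀ n, dist (s^[n] p) (s^[n] q) ≤ 1 := by
    intro n
    rw [Prod.dist_eq]
    exact max_le (hdΛ _ (hmemp n).1.1 _ (hmemq n).1.1) (hdI _ (hmemp n).1.2 _ (hmemq n).1.2)
  have hbdd : IsBoundedUnder (· ≤ ·) atTop fun n : ℕ => dist (s^[n] p) (s^[n] q) :=
    isBoundedUnder_of ⟨1, hle⟩
  have hbdd' : IsBoundedUnder (· ≥ ·) atTop fun n : ℕ => dist (s^[n] p) (s^[n] q) :=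
    isBoundedUnder_of ⟨0, fun _ => dist_nonneg⟩
  refine ⟨⟨hp.1, Ioc_subset_Icc_self hp.2⟩, ⟨hq.1, Ioc_subset_Icc_self hq.2⟩, le_antisymm ?_ ?_, ?_⟩
  · have hm : ∀ m : ℕ, liminf (fun n : ℕ => dist (s^[n] p) (s^[n] q)) atTop ≤
        max (β₁ ^ m) ((1 / 2) ^ m) := by
      intro m
      refine liminf_le_of_frequently_le (frequently_atTop.2 fun a => ?_) hbdd'
      obtain ⟨n, hn, hnp, hnq⟩ := frequently_atTop.1 (hnear m) a
      have hsub : Ioo (0 : ℝ) ((1 / 4) ^ m) ⊆ Ioc 0 1 := fun x hx =>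
        ⟨hx.1, hx.2.le.trans (pow_le_one₀ (by norm_num) (by norm_num))⟩
      rw [← (hmemp n).2] at hnp
      rw [← (hmemq n).2] at hnq
      have hup := eq_of_coe_mem_image (hmemp n).1.2 hsub hnp
      have huq := eq_of_coe_mem_image (hmemq n).1.2 hsub hnq
      have hpow : (2 : ℝ) ^ m * (1 / 4) ^ m = (1 / 2) ^ m := by rw [← mul_pow]; norm_num
      have hscale : ∀ x ∈ Ioo (0 : ℝ) ((1 / 4) ^ m), 2 ^ m * x ∈ Icc (0 : ℝ) ((1 / 2) ^ m) := by
        intro x hx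
        refine ⟨mul_nonneg (by positivity) hx.1.le, ?_⟩
        rw [← hpow]
        gcongr
        exact hx.2.le
      have hhalf : ((1 / 2 : ℝ)) ^ m ≤ 1 := pow_le_one₀ (by norm_num) (by norm_num)
      refine ⟨m + n, by omega, ?_⟩
      rw [Function.iterate_add_apply, Function.iterate_add_apply,
        solenoid_iterate_of_small hs m _ ((hscale _ hup).2.trans hhalf),
        solenoid_iterate_of_small hs m _ ((hscale _ huq).2.trans hhalf), Prod.dist_eq]
      refine max_le_max ?_ ?_
      · simp only
        rw [dist_smul₀, Real.norm_of_nonneg (pow_nonneg hβ₁.1.le m)]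
        exact mul_le_of_le_one_right (pow_nonneg hβ₁.1.le m)
          (hdΛ _ (hmemp n).1.1 _ (hmemq n).1.1)
      · simpa using Real.dist_le_of_mem_Icc (hscale _ hup) (hscale _ huq)
    have hlim : Tendsto (fun m : ℕ => max (β₁ ^ m) ((1 / 2 : ℝ) ^ m)) atTop (𝓝 0) := by
      simpa using (tendsto_pow_atTop_nhds_zero_of_lt_one hβ₁.1.le hβ₁.2).max
        (tendsto_pow_atTop_nhds_zero_of_lt_one (r := (1 / 2 : ℝ)) (by norm_num) (by norm_num))
    exact ge_of_tendsto' hlim hm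
  · exact le_liminf_of_le hbdd.isCoboundedUnder_ge (Eventually.of_forall fun _ => dist_nonneg)
  · refine lt_of_lt_of_le (by linarith : 0 < 1 - β₂ - β₁)
      (le_limsup_of_frequently_le (frequently_atTop.2 fun a => ?_) hbdd)
    obtain ⟨n, hn, hnp, hnq⟩ := frequently_atTop.1 hfar a
    rw [← (hmemp n).2] at hnp
    rw [← (hmemq n).2] at hnq
    have hup := eq_of_coe_mem_image (hmemp n).1.2
      (fun x hx => ⟨hx.1, by linarith [hx.2]⟩) hnp
    have huq := eq_of_coe_mem_image (hmemq n).1.2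
      (fun x hx => ⟨by linarith [hx.1], hx.2.le⟩) hnq
    refine ⟨n + 1, by omega, ?_⟩
    rw [Function.iterate_succ_apply', Function.iterate_succ_apply', hs, if_pos hup.2.le, hs,
      if_neg (not_le.2 huq.1), Prod.dist_eq, Prod.dist_eq]
    refine le_max_of_le_left (le_max_of_le_left ?_)
    have hx := (hΛ (hmemp n).1.1).1
    have hy := (hΛ (hmemq n).1.1).1
    rw [Real.dist_eq, abs_sub_comm]
    refine le_trans ?_ (le_abs_self _)
    nlinarith [hx.1, hx.2, hy.1, hy.2, hβ₁.1, hβ₂.1]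

/-- The self-similar measure of dimension `D` on the attractor. -/
theorem exists_isFrostman_attractor (hβ₁ : β₁ ∈ Ioo (0 : ℝ) 1) (hβ₂ : β₂ ∈ Ioo (0 : ℝ) 1)
    (hsum : β₁ + β₂ < 1) (hΛc : IsCompact Λ) (hΛne : Λ.Nonempty)
    (h₁ : ∀ q ∈ Λ, (β₁ * q.1, β₁ * q.2) ∈ Λ)
    (h₂ : ∀ q ∈ Λ, (1 - β₂ + β₂ * q.1, 1 - β₂ + β₂ * q.2) ∈ Λ)
    (hΛ : Λ ⊆ Icc 0 1 ×ˢ Icc 0 1) {D : ℝ} (hD0 : 0 < D) (hD : β₁ ^ D + β₂ ^ D = 1) :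
    ∃ μ : Measure (ℝ × ℝ), IsProbabilityMeasure μ ∧ μ Λᶜ = 0 ∧ IsFrostman μ D := by
  set b : Bool → ℝ≥0 := fun i => bif i then β₂.toNNReal else β₁.toNNReal
  set c : Bool → ℝ := fun i => bif i then 1 - β₂ else 0
  set T : Bool → ℝ × ℝ → ℝ × ℝ := fun i q => (c i + b i * q.1, c i + b i * q.2)
  have hbf : (b false : ℝ) = β₁ := Real.coe_toNNReal _ hβ₁.1.le
  have hbt : (b true : ℝ) = β₂ := Real.coe_toNNReal _ hβ₂.1.le
  have hb01 : ∀ i, b i ∈ Ioo 0 1 := by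
    rintro (_ | _)
    · exact ⟨Real.toNNReal_pos.2 hβ₁.1, Real.toNNReal_lt_one.2 hβ₁.2⟩
    · exact ⟨Real.toNNReal_pos.2 hβ₂.1, Real.toNNReal_lt_one.2 hβ₂.2⟩
  have hTe : ∀ i x y, edist (T i x) (T i y) = b i * edist x y := by
    intro i x y
    rw [edist_dist, edist_dist, show dist (T i x) (T i y) = b i * dist x y from
      dist_similitude _ _ (NNReal.coe_nonneg (b i)) x y, ENNReal.ofReal_mul (NNReal.coe_nonneg (b i)),
      ENNReal.ofReal_coe_nnreal]
  have hTΛ : ∀ i, MapsTo (T i) Λ Λ := by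
    rintro (_ | _) q hq
    · simpa [T, hbf, c] using h₁ q hq
    · simpa [T, hbt, c] using h₂ q hq
  have hpsum : (b false : ℝ≥0∞) ^ D + (b true : ℝ≥0∞) ^ D = 1 := by
    rw [← ENNReal.coe_rpow_of_nonneg _ hD0.le, ← ENNReal.coe_rpow_of_nonneg _ hD0.le,
      ← ENNReal.coe_add, ENNReal.coe_eq_one]
    exact NNReal.eq (by simpa [hbf, hbt] using hD)
  set ρ : Measure Bool :=
    (b false : ℝ≥0∞) ^ D • dirac false + (b true : ℝ≥0∞) ^ D • dirac true with hρ
  have : IsProbabilityMeasure ρ := ⟨by simp [hρ, hpsum]⟩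
  set B : ℝ≥0 := max (b false) (b true) with hB
  have hB1 : B < 1 := max_lt (hb01 false).2 (hb01 true).2
  have hTL : ∀ i, LipschitzWith B (T i) := by
    intro i x y
    rw [hTe]
    gcongr
    cases i
    · exact le_max_left _ _
    · exact le_max_right _ _
  obtain ⟨μ, hμ, hμΛ, hμT⟩ := exists_selfSimilar_measure ρ T hB1 hTL hΛc hΛne hTΛ
  refine ⟨μ, hμ, hμΛ, isFrostman_of_selfSimilar hμΛ hb01 hTe
    (δ := (1 - β₂ - β₁).toNNReal) ?_ ?_ hD0 ?_⟩
  · exact Real.toNNReal_pos.2 (by linarith)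
  · intro x hx y hy
    rw [edist_dist]
    refine ENNReal.ofReal_le_ofReal ?_
    rw [Prod.dist_eq]
    refine le_max_of_le_left ?_
    have hx := (hΛ hx).1
    have hy := (hΛ hy).1
    rw [Real.dist_eq, abs_sub_comm]
    refine le_trans ?_ (le_abs_self _)
    simp only [T, hbf, hbt, c, cond_true, cond_false]
    nlinarith [hx.1, hx.2, hy.1, hy.2, hβ₁.1, hβ₂.1]
  · intro U hU
    rw [hμT U hU, hρ, lintegral_add_measure, lintegral_smul_measure, lintegral_smul_measure,
      lintegral_dirac, lintegral_dirac, smul_eq_mul, smul_eq_mul]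

theorem hasCovers_unitInterval : HasCovers (Icc (0 : ℝ) 1) 1 := by
  have hL : ∀ c : ℝ, LipschitzWith (1 / 2) fun x : ℝ => c + x / 2 := by
    intro c
    refine LipschitzWith.of_dist_le_mul fun x y => ?_
    simp only [Real.dist_eq, add_sub_add_left_eq_sub, ← sub_div, abs_div, abs_two]
    apply le_of_eq
    push_cast
    ring
  have hh : (1 / 2 : ℝ≥0) ∈ Ioo 0 1 := ⟨by norm_num, by norm_num⟩
  refine hasCovers_of_subset_image_union (by simp) (hL 0) (hL (1 / 2)) hh hh ?_ one_pos
    (by norm_num)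
  rintro x ⟨hx0, hx1⟩
  rcases le_total x (1 / 2) with h | h
  · exact Or.inl ⟨2 * x, ⟨by linarith, by linarith⟩, by ring⟩
  · exact Or.inr ⟨2 * x - 1, ⟨by linarith, by linarith⟩, by ring⟩

theorem isFrostman_volume_unitInterval : IsFrostman (volume.restrict (Ioc (0 : ℝ) 1)) 1 :=
  ⟨1, fun U => by
    simpa only [ENNReal.coe_one, one_mul, ENNReal.rpow_one] using
      (restrict_apply_le _ U).trans (Real.volume_le_diam U)⟩

end Solenoid

/-- Let `β₁, β₂ ∈ (0,1)` with `β₁ + β₂ < 1`, and let `s` be the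
solenoid-like map `s(x,y,z) = (β₁x, β₁y, 2z)` if `z ≤ 1/2` and
`s(x,y,z) = (1 − β₂ + β₂x, 1 − β₂ + β₂y, 2z − 1)` if `z > 1/2`, modelled on `(ℝ × ℝ) × ℝ`
with first component `(x,y)` and second component `z`. Let `Λ ⊆ ℝ²` be the attractor of
the planar similitudes `T₁(x,y) = (β₁x, β₁y)` and `T₂(x,y) = (1 − β₂ + β₂x, 1 − β₂ + β₂y)`
and let `D` solve `β₁^D + β₂^D = 1`. Then the Li-Yorke pairs of `s` in `Λ × [0,1]` have
full Hausdorff dimension: `dim_H LY_s(Λ × [0,1]) = dim_H ((Λ × [0,1])²) = 2(D + 1)`. -/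
theorem dimH_liYorkePairs_solenoid (β₁ β₂ : ℝ)
    (hβ₁ : β₁ ∈ Set.Ioo (0 : ℝ) 1) (hβ₂ : β₂ ∈ Set.Ioo (0 : ℝ) 1) (hsum : β₁ + β₂ < 1)
    (s : (ℝ × ℝ) × ℝ → (ℝ × ℝ) × ℝ)
    (hs : ∀ p : (ℝ × ℝ) × ℝ,
      s p = if p.2 ≤ 1 / 2 then ((β₁ * p.1.1, β₁ * p.1.2), 2 * p.2)
        else ((1 - β₂ + β₂ * p.1.1, 1 - β₂ + β₂ * p.1.2), 2 * p.2 - 1))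
    (Λ : Set (ℝ × ℝ)) (hΛc : IsCompact Λ) (hΛne : Λ.Nonempty)
    (hΛ : Λ = (fun q : ℝ × ℝ => (β₁ * q.1, β₁ * q.2)) '' Λ ∪
      (fun q : ℝ × ℝ => (1 - β₂ + β₂ * q.1, 1 - β₂ + β₂ * q.2)) '' Λ)
    (D : ℝ) (hD : β₁ ^ D + β₂ ^ D = 1) :
    dimH (liYorkePairs s (Λ ×ˢ Set.Icc (0 : ℝ) 1)) =
      dimH ((Λ ×ˢ Set.Icc (0 : ℝ) 1) ×ˢ (Λ ×ˢ Set.Icc (0 : ℝ) 1)) ∧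
    dimH ((Λ ×ˢ Set.Icc (0 : ℝ) 1) ×ˢ (Λ ×ˢ Set.Icc (0 : ℝ) 1)) =
      ENNReal.ofReal (2 * (D + 1)) := by
  have hD0 : 0 < D := by
    by_contra! h
    have e₁ := Real.one_le_rpow_of_pos_of_le_one_of_nonpos hβ₁.1 hβ₁.2.le h
    have e₂ := Real.one_le_rpow_of_pos_of_le_one_of_nonpos hβ₂.1 hβ₂.2.le h
    linarith
  have h₁ : ∀ q ∈ Λ, (β₁ * q.1, β₁ * q.2) ∈ Λ := fun q hq => by
    rw [hΛ]; exact Or.inl ⟨q, hq, rfl⟩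
  have h₂ : ∀ q ∈ Λ, (1 - β₂ + β₂ * q.1, 1 - β₂ + β₂ * q.2) ∈ Λ := fun q hq => by
    rw [hΛ]; exact Or.inr ⟨q, hq, rfl⟩
  have hΛI : Λ ⊆ Icc 0 1 ×ˢ Icc 0 1 := by
    intro q hq
    refine ⟨subset_Icc_of_attractor hβ₁ hβ₂ (hΛc.image continuous_fst) ?_
        (mem_image_of_mem _ hq),
      subset_Icc_of_attractor hβ₁ hβ₂ (hΛc.image continuous_snd) ?_ (mem_image_of_mem _ hq)⟩
    all_goals
      rintro _ ⟨r, hr, rfl⟩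
      rw [hΛ] at hr
      rcases hr with ⟨t, ht, rfl⟩ | ⟨t, ht, rfl⟩
      · exact ⟨_, mem_image_of_mem _ ht, Or.inl rfl⟩
      · exact ⟨_, mem_image_of_mem _ ht, Or.inr rfl⟩
  have hΛcov : HasCovers Λ D := by
    refine hasCovers_of_subset_image_union (b₁ := β₁.toNNReal) (b₂ := β₂.toNNReal)
      ?_ ?_ ?_ ⟨Real.toNNReal_pos.2 hβ₁.1, Real.toNNReal_lt_one.2 hβ₁.2⟩
      ⟨Real.toNNReal_pos.2 hβ₂.1, Real.toNNReal_lt_one.2 hβ₂.2⟩ hΛ.le hD0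
      (by rwa [Real.coe_toNNReal _ hβ₁.1.le, Real.coe_toNNReal _ hβ₂.1.le])
    · refine (Metric.ediam_mono hΛI).trans ((ediam_prod_le_max _ _).trans ?_)
      simp
    · exact LipschitzWith.of_dist_le_mul fun x y => by
        simpa [Real.coe_toNNReal _ hβ₁.1.le] using (dist_similitude β₁ 0 hβ₁.1.le x y).le
    · exact LipschitzWith.of_dist_le_mul fun x y => by
        simpa [Real.coe_toNNReal _ hβ₂.1.le] using (dist_similitude β₂ (1 - β₂) hβ₂.1.le x y).le
  set d : NNReal := ⟨D + 1 + (D + 1), by linarith⟩ with hd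
  have hdD : ENNReal.ofReal (2 * (D + 1)) = d := by
    rw [two_mul, ← ENNReal.ofReal_coe_nnreal]; rfl
  have hupper : dimH ((Λ ×ˢ Set.Icc (0 : ℝ) 1) ×ˢ (Λ ×ˢ Set.Icc (0 : ℝ) 1)) ≤ d :=
    HasCovers.dimH_le ((hΛcov.prod hasCovers_unitInterval).prod
      (hΛcov.prod hasCovers_unitInterval))
  have hsub : liYorkePairs s (Λ ×ˢ Set.Icc (0 : ℝ) 1) ⊆
      (Λ ×ˢ Set.Icc (0 : ℝ) 1) ×ˢ (Λ ×ˢ Set.Icc (0 : ℝ) 1) := fun p hp => ⟨hp.1, hp.2.1⟩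
  have hlower : d ≤ dimH (liYorkePairs s (Λ ×ˢ Set.Icc (0 : ℝ) 1)) := by
    obtain ⟨μ, hμ, hμΛ, hμD⟩ :=
      exists_isFrostman_attractor hβ₁ hβ₂ hsum hΛc hΛne h₁ h₂ hΛI hD0 hD
    set lam := MeasureTheory.volume.restrict (Ioc (0 : ℝ) 1) with hlam
    have : MeasureTheory.IsProbabilityMeasure lam := ⟨by simp [hlam]⟩
    have hF := hμD.prod hD0.le zero_le_one isFrostman_volume_unitInterval
    refine (hF.prod (by linarith) (by linarith) hF).le_dimH (d := d) ?_
    have hsnd : MeasureTheory.MeasurePreserving Prod.snd (μ.prod lam) lam :=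
      MeasureTheory.measurePreserving_snd
    have hfst : MeasureTheory.MeasurePreserving Prod.fst (μ.prod lam) μ :=
      MeasureTheory.measurePreserving_fst
    have hmem : ∀ᵐ p ∂μ.prod lam, p ∈ Λ ×ˢ Ioc (0 : ℝ) 1 := by
      filter_upwards [hfst.quasiMeasurePreserving.ae (MeasureTheory.mem_ae_iff.2 hμΛ),
        hsnd.quasiMeasurePreserving.ae (MeasureTheory.ae_restrict_mem measurableSet_Ioc)]
        with p hp hp' using ⟨hp, hp'⟩
    have hq := (hsnd.prod hsnd).quasiMeasurePreserving
    have hae : ∀ᵐ p ∂(μ.prod lam).prod (μ.prod lam),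
        p ∈ liYorkePairs s (Λ ×ˢ Set.Icc (0 : ℝ) 1) := by
      filter_upwards [
        MeasureTheory.measurePreserving_fst.quasiMeasurePreserving.ae hmem,
        MeasureTheory.measurePreserving_snd.quasiMeasurePreserving.ae hmem,
        MeasureTheory.ae_all_iff.2 fun m : ℕ => hq.ae
          (ae_frequently_doubling_mem (isOpen_Ioo (a := (0 : ℝ)) (b := (1 / 4) ^ m))
            (isOpen_Ioo (a := (0 : ℝ)) (b := (1 / 4) ^ m))
            (nonempty_Ioo.2 (by positivity)) (nonempty_Ioo.2 (by positivity))),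
        hq.ae (ae_frequently_doubling_mem (isOpen_Ioo (a := (0 : ℝ)) (b := 1 / 2))
          (isOpen_Ioo (a := 1 / 2) (b := 1)) (nonempty_Ioo.2 (by norm_num))
          (nonempty_Ioo.2 (by norm_num)))] with p hp hp' hnear hfar
      exact mem_liYorkePairs_solenoid hβ₁ hβ₂ hsum hs h₁ h₂ hΛI hp hp' hnear hfar
    intro h0
    have huniv := MeasureTheory.measure_mono_null (fun p _ => by
      by_cases hp : p ∈ liYorkePairs s (Λ ×ˢ Set.Icc (0 : ℝ) 1)
      · exact Or.inl hp
      · exact Or.inr hp : (univ : Set (((ℝ × ℝ) × ℝ) × ((ℝ × ℝ) × ℝ))) ⊆ _)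
      (MeasureTheory.measure_union_null h0 hae)
    simp at huniv
  rw [hdD]
  exact ⟨le_antisymm (dimH_mono hsub) (hupper.trans hlower),
    le_antisymm hupper (hlower.trans (dimH_mono hsub))⟩

end
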